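/- arXiv:1606.08345 — 7 statements merged into one kernel-verified Lean document; each statement's English description precedes it below -/
import Mathlib

section
/- Let A be a complex Banach algebra and let φ : A → ℂ be a nonzero continuous multiplicative linear functional. If A is left φ-contractible and right φ-contractible, then A is φ-inner amenable; that is, there exist an index type ι, a proper (nontrivial) filter l on ι, and a function a : ι → A with bounded range such that for every x ∈ A the net x·a(i) − a(i)·x tends to 0 along l, and φ(a(i)) tends to 1 along l. (A constant net given by the element m with a·m = m·a = φ(a)·m, φ(m) = 1, witnesses this.) -/
/-- If a complex Banach algebra `A` with nonzero continuous multiplicative linear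
functional `φ` is left and right `φ`-contractible, then `A` is `φ`-inner amenable:
there is a bounded net `(a_i)` (a function from an index type with a proper filter)
with `x * a_i - a_i * x → 0` for every `x` and `φ (a_i) → 1`. -/
theorem phi_contractible_implies_phi_inner_amenable
    {A : Type*} [NonUnitalNormedRing A] [NormedSpace ℂ A]
    [IsScalarTower ℂ A A] [SMulCommClass ℂ A A] [CompleteSpace A]
    (φ : A →L[ℂ] ℂ) (hφmul : ∀ a b : A, φ (a * b) = φ a * φ b) (hφ : φ ≠ 0)
    (hleft : ∃ m₁ : A, (∀ a : A, a * m₁ = φ a • m₁) ∧ φ m₁ = 1)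
    (hright : ∃ m₂ : A, (∀ a : A, m₂ * a = φ a • m₂) ∧ φ m₂ = 1) :
    ∃ (ι : Type) (l : Filter ι), l.NeBot ∧ ∃ a : ι → A,
      Bornology.IsBounded (Set.range a) ∧
      (∀ x : A, Filter.Tendsto (fun i => x * a i - a i * x) l (nhds 0)) ∧
      Filter.Tendsto (fun i => φ (a i)) l (nhds 1) := by
  obtain ⟨m₁, hm₁, hφ₁⟩ := hleft
  obtain ⟨m₂, hm₂, hφ₂⟩ := hright
  have heq : m₁ = m₂ := by
    have h := (hm₁ m₂).symm.trans (hm₂ m₁)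
    rwa [hφ₁, hφ₂, one_smul, one_smul] at h
  subst heq
  refine ⟨Unit, ⊤, inferInstance, fun _ => m₁, (Set.finite_range _).isBounded, fun x => ?_, ?_⟩
  · simp only [hm₁, hm₂, sub_self]
    exact tendsto_const_nhds
  · simp only [hφ₁]
    exact tendsto_const_nhds
end

section
/- Let A be a unital complex Banach algebra, let φ : A → ℂ be a unital algebra homomorphism (a character), and let n ≥ 2. Let J be the set of n×n matrices over A all of whose columns vanish except possibly the last column (M i j = 0 whenever j ≠ n−1, using indices 0,…,n−1), and define ψ(M) = φ(M (n−1) (n−1)). Then there is no element m ∈ J such that j·m = ψ(j)·m for all j ∈ J and ψ(m) = 1; that is, J is not left ψ-contractible. -/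
/-- Let `A` be a unital complex Banach algebra with character `φ`, `n ≥ 2`, and let `J`
be the set of `n × n` matrices over `A` supported on the last column.  With
`ψ M = φ (M (n-1) (n-1))`, the ideal `J` is not left `ψ`-contractible. -/
theorem last_column_ideal_not_left_psi_contractible
    {A : Type*} [NormedRing A] [NormedAlgebra ℂ A] [CompleteSpace A]
    (φ : A →ₐ[ℂ] ℂ) (n : ℕ) (hn : 2 ≤ n)
    (J : Set (Matrix (Fin n) (Fin n) A))
    (hJ : J = {M | ∀ i j : Fin n, j ≠ ⟨n - 1, by omega⟩ → M i j = 0})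
    (ψ : Matrix (Fin n) (Fin n) A → ℂ)
    (hψ : ψ = fun M => φ (M ⟨n - 1, by omega⟩ ⟨n - 1, by omega⟩)) :
    ¬ ∃ m ∈ J, (∀ j ∈ J, j * m = ψ j • m) ∧ ψ m = 1 := by
  subst hJ hψ
  rintro ⟨m, -, hm, hone⟩
  have hne : (⟨0, by omega⟩ : Fin n) ≠ ⟨n - 1, by omega⟩ := by
    simp only [ne_eq, Fin.mk.injEq]
    omega
  -- The matrix unit in the top right corner lies in `J ∩ ker ψ` and moves the last row of `m`
  -- to the top row.
  have h := hm (Matrix.single ⟨0, by omega⟩ ⟨n - 1, by omega⟩ 1)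
    fun i j hj => Matrix.single_apply_of_col_ne _ _ hj.symm _
  have hcorner := congrFun (congrFun h ⟨0, by omega⟩) ⟨n - 1, by omega⟩
  rw [Matrix.single_mul_apply_same, one_mul] at hcorner
  simp only [Matrix.single_apply_of_row_ne hne, map_zero, zero_smul, Matrix.zero_apply]
    at hcorner
  simp [hcorner] at hone
end

section
/- Let A be a unital complex Banach algebra, let φ : A → ℂ be a unital algebra homomorphism (a character), and let n ≥ 2. Let B be the algebra of upper triangular n×n matrices over A (M i j = 0 whenever j < i), and define ψ(M) = φ(M (n−1) (n−1)). Then there is no element m ∈ B such that b·m = ψ(b)·m for all b ∈ B and ψ(m) = 1; that is, the upper triangular matrix algebra B is not left ψ-contractible. -/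
/-- Let `A` be a unital complex Banach algebra with character `φ` and `n ≥ 2`.  The
algebra `B` of upper triangular `n × n` matrices over `A`, with the character
`ψ M = φ (M (n-1) (n-1))`, is not left `ψ`-contractible. -/
theorem upper_triangular_not_left_psi_contractible
    {A : Type*} [NormedRing A] [NormedAlgebra ℂ A] [CompleteSpace A]
    (φ : A →ₐ[ℂ] ℂ) (n : ℕ) (hn : 2 ≤ n)
    (B : Set (Matrix (Fin n) (Fin n) A))
    (hB : B = {M | ∀ i j : Fin n, j < i → M i j = 0})
    (ψ : Matrix (Fin n) (Fin n) A → ℂ)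
    (hψ : ψ = fun M => φ (M ⟨n - 1, by omega⟩ ⟨n - 1, by omega⟩)) :
    ¬ ∃ m ∈ B, (∀ b ∈ B, b * m = ψ b • m) ∧ ψ m = 1 := by
  subst hB hψ
  rintro ⟨m, -, hm, hm1⟩
  let first : Fin n := ⟨0, by omega⟩
  let last : Fin n := ⟨n - 1, by omega⟩
  have hlt : first < last := Fin.mk_lt_mk.mpr (by omega)
  have hmem : ∀ i j : Fin n, j < i → Matrix.single first last (1 : A) i j = 0 := by
    intro i j hji
    apply Matrix.single_apply_of_ne
    rintro ⟨rfl, rfl⟩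
    exact lt_asymm hji hlt
  have hψ0 : Matrix.single first last (1 : A) last last = 0 :=
    Matrix.single_apply_of_ne _ _ _ _ _ fun h => hlt.ne h.1
  have hentry : m last last = 0 := by
    have h := congrFun (congrFun (hm (Matrix.single first last 1) hmem) first) last
    change _ = (φ (Matrix.single first last (1 : A) last last) • m) first last at h
    rwa [Matrix.single_mul_apply_same, one_mul, hψ0, map_zero, zero_smul] at h
  change φ (m last last) = 1 at hm1
  rw [hentry, map_zero] at hm1
  exact zero_ne_one hm1
end

section
/- Let A be a unital complex Banach algebra, let φ : A → ℂ be a unital algebra homomorphism (a character), and let n ≥ 2. Let B be the algebra of upper triangular n×n matrices over A (M i j = 0 whenever j < i), and define ψ₀(M) = φ(M 0 0), the character evaluating φ at the first diagonal entry. Then there is no element m ∈ B such that m·b = ψ₀(b)·m for all b ∈ B and ψ₀(m) = 1; that is, B is not right ψ₀-contractible. -/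
/-- Let `A` be a unital complex Banach algebra with character `φ` and `n ≥ 2`.  The
algebra `B` of upper triangular `n × n` matrices over `A`, with the character
`ψ₀ M = φ (M 0 0)`, is not right `ψ₀`-contractible. -/
theorem upper_triangular_not_right_psi_zero_contractible
    {A : Type*} [NormedRing A] [NormedAlgebra ℂ A] [CompleteSpace A]
    (φ : A →ₐ[ℂ] ℂ) (n : ℕ) (hn : 2 ≤ n)
    (B : Set (Matrix (Fin n) (Fin n) A))
    (hB : B = {M | ∀ i j : Fin n, j < i → M i j = 0})
    (ψ₀ : Matrix (Fin n) (Fin n) A → ℂ)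
    (hψ₀ : ψ₀ = fun M => φ (M ⟨0, by omega⟩ ⟨0, by omega⟩)) :
    ¬ ∃ m ∈ B, (∀ b ∈ B, m * b = ψ₀ b • m) ∧ ψ₀ m = 1 := by
  subst hB hψ₀
  rintro ⟨m, -, hm, hm_one⟩
  have hE : Matrix.single (⟨0, by omega⟩ : Fin n) ⟨1, by omega⟩ (1 : A) ∈
      {M : Matrix (Fin n) (Fin n) A | ∀ i j : Fin n, j < i → M i j = 0} := by
    intro i j hji
    refine Matrix.single_apply_of_ne _ _ _ _ _ ?_
    rintro ⟨rfl, rfl⟩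
    simp at hji
  have h := congrFun (congrFun (hm _ hE) ⟨0, by omega⟩) ⟨1, by omega⟩
  have hm_zero : m ⟨0, by omega⟩ ⟨0, by omega⟩ = 0 := by
    simpa [Matrix.single_apply] using h
  simp [hm_zero] at hm_one
end

section
/- Let A₀ be the subalgebra of 2×2 complex matrices with zero first column, and let φ₀ : A₀ → ℂ be the character φ₀(x) = x 1 1 (the bottom-right entry). Then there is no element m ∈ A₀ such that m·x = x·m for all x ∈ A₀ and φ₀(m) = 1. (Such an element would force every x ∈ A₀ to equal φ₀(x)·m, contradicting that A₀ is two-dimensional.) -/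
/-- In the subalgebra `A₀` of `2 × 2` complex matrices with zero first column, with
character `φ₀ x = x 1 1`, there is no `m ∈ A₀` commuting with every element of `A₀`
and satisfying `φ₀ m = 1`. -/
theorem no_central_element_with_phi_zero_one
    (A₀ : Set (Matrix (Fin 2) (Fin 2) ℂ))
    (hA₀ : A₀ = {x | x 0 0 = 0 ∧ x 1 0 = 0}) :
    ¬ ∃ m ∈ A₀, (∀ x ∈ A₀, m * x = x * m) ∧ m 1 1 = 1 := by
  subst hA₀
  rintro ⟨m, ⟨h00, -⟩, hcomm, h11⟩
  have h := congrFun₂ (hcomm !![0, 1; 0, 0] (by simp)) 0 1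
  simp [Matrix.mul_apply, Fin.sum_univ_two, h00, h11] at h
end

section
/- Let A₀ be the subalgebra of 2×2 complex matrices with zero first column, and let φ₀ : A₀ → ℂ be the character φ₀(x) = x 1 1. Then A₀ is not φ₀-inner amenable: for every index type ι, every proper (nontrivial) filter l on ι, and every function a : ι → A₀ with bounded range, it is not the case that simultaneously (i) for every x ∈ A₀ the net x·a(i) − a(i)·x tends to 0 along l, and (ii) φ₀(a(i)) tends to 1 along l. -/
attribute [local instance] Matrix.normedAddCommGroup

/-- The subalgebra `A₀` of `2 × 2` complex matrices with zero first column, with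
character `φ₀ x = x 1 1`, is not `φ₀`-inner amenable: no bounded net `(a i)` in `A₀`
satisfies both `x * a i - a i * x → 0` for all `x ∈ A₀` and `φ₀ (a i) → 1`. -/
theorem zero_first_column_algebra_not_phi_inner_amenable
    (A₀ : Set (Matrix (Fin 2) (Fin 2) ℂ))
    (hA₀ : A₀ = {x | x 0 0 = 0 ∧ x 1 0 = 0})
    (ι : Type*) (l : Filter ι) (hl : l.NeBot)
    (a : ι → Matrix (Fin 2) (Fin 2) ℂ) (ha : ∀ i, a i ∈ A₀)
    (hbdd : Bornology.IsBounded (Set.range a)) :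
    ¬ ((∀ x ∈ A₀, Filter.Tendsto (fun i => x * a i - a i * x) l (nhds 0)) ∧
       Filter.Tendsto (fun i => (a i) 1 1) l (nhds 1)) := by
  rintro ⟨hcomm, hφ⟩
  subst hA₀
  have h := hcomm !![0, 1; 0, 0] (by simp)
  have hentry : Filter.Tendsto (fun i => (a i) 1 1) l (nhds 0) := by
    refine ((tendsto_pi_nhds.1 (tendsto_pi_nhds.1 h 0)) 1).congr fun i => ?_
    simp [Matrix.vecMul, dotProduct, Matrix.mul_apply, Fin.sum_univ_two, (ha i).1]
  exact one_ne_zero (tendsto_nhds_unique hφ hentry)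
end

section
/- Let B be a complex Banach algebra, let ψ : B → ℂ be a nonzero continuous multiplicative linear functional, and let J be a closed two-sided ideal of B such that the restriction of ψ to J is nonzero. If B is left ψ-contractible (there exists m ∈ B with b·m = ψ(b)·m for all b ∈ B and ψ(m) = 1), then J is left ψ-contractible: there exists m′ ∈ J such that j·m′ = ψ(j)·m′ for all j ∈ J and ψ(m′) = 1. (One may take m′ = m·j₀ for any j₀ ∈ J with ψ(j₀) = 1.) -/
/-- Let `B` be a complex Banach algebra with nonzero continuous multiplicative linear
functional `ψ`, and let `J` be a closed two-sided ideal of `B` on which `ψ` does not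
vanish identically.  If `B` is left `ψ`-contractible, then so is `J`. -/
theorem closed_ideal_left_psi_contractible
    {B : Type*} [NonUnitalNormedRing B] [NormedSpace ℂ B]
    [IsScalarTower ℂ B B] [SMulCommClass ℂ B B] [CompleteSpace B]
    (ψ : B →L[ℂ] ℂ) (hψmul : ∀ a b : B, ψ (a * b) = ψ a * ψ b) (hψ : ψ ≠ 0)
    (J : Submodule ℂ B) (hJclosed : IsClosed (J : Set B))
    (hJl : ∀ b : B, ∀ x ∈ J, b * x ∈ J) (hJr : ∀ b : B, ∀ x ∈ J, x * b ∈ J)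
    (hψJ : ∃ j ∈ J, ψ j ≠ 0)
    (hB : ∃ m : B, (∀ b : B, b * m = ψ b • m) ∧ ψ m = 1) :
    ∃ m' ∈ J, (∀ j ∈ J, j * m' = ψ j • m') ∧ ψ m' = 1 := by
  obtain ⟨m, hm, hm1⟩ := hB
  obtain ⟨j₀, hj₀, hne⟩ := hψJ
  refine ⟨m * ((ψ j₀)⁻¹ • j₀), hJl _ _ (J.smul_mem _ hj₀), fun j _ => ?_, ?_⟩
  · rw [← mul_assoc, hm, smul_mul_assoc]
  · rw [hψmul, hm1, map_smul, smul_eq_mul, inv_mul_cancel₀ hne, mul_one]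
end
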